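/- Let d ≥ 1 and let A, B, C be real d×d matrices with A symmetric positive definite. Define g(t) = A + t•B + t²•C for t ∈ ℝ. Then, as t → 0, √(det g(t)) = √(det A) · (1 + (t/2)·trace(A⁻¹ * B)) + O(t²); that is, the function t ↦ √(det g(t)) - √(det A)·(1 + (t/2)·trace(A⁻¹B)) is O(t²). -/

import Mathlib

open Filter Asymptotics

lemma Real.abs_sqrt_one_add_sub_le (y : ℝ) :
    |Real.sqrt (1 + y) - (1 + y / 2)| ≤ y ^ 2 / 2 := by
  rcases le_total 0 (1 + y) with h | h
  · have hs := Real.sqrt_nonneg (1 + y)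
    have hq := Real.sq_sqrt h
    generalize Real.sqrt (1 + y) = s at hs hq ⊢
    obtain rfl : y = s ^ 2 - 1 := by linarith
    rw [abs_le]
    constructor
    · nlinarith [mul_nonneg (sq_nonneg (s - 1)) (mul_nonneg hs (by linarith : 0 ≤ s + 2))]
    · nlinarith [sq_nonneg (s - 1), sq_nonneg (s ^ 2 - 1)]
  · rw [Real.sqrt_eq_zero_of_nonpos h, abs_le]
    constructor <;> nlinarith

/-- The determinant of `1 + t • P + t ^ 2 • Q` is a polynomial in `t` whose expansion starts with
`1 + t * P.trace`. -/
lemma Matrix.exists_det_one_add_smul_add_sq_smul {n R : Type*} [Fintype n] [DecidableEq n]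
    [CommRing R] (P Q : Matrix n n R) :
    ∃ q : Polynomial R, ∀ t : R,
      (1 + t • P + t ^ 2 • Q).det = 1 + t * P.trace + t ^ 2 * q.eval t := by
  let M : Matrix n n (Polynomial R) :=
    P.map Polynomial.C + (Polynomial.X : Polynomial R) • Q.map Polynomial.C
  have hM := Matrix.det_one_add_smul (Polynomial.X : Polynomial R) M
  have htr : M.trace = Polynomial.C P.trace + Polynomial.X * Polynomial.C Q.trace := by
    simp [M, Matrix.trace, Finset.sum_add_distrib, Finset.mul_sum]
  rw [htr] at hM
  generalize Polynomial.eval (Polynomial.X : Polynomial R) _ = r at hM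
  refine ⟨Polynomial.C Q.trace + r, fun t => ?_⟩
  have h := congrArg (Polynomial.evalRingHom t) hM
  rw [RingHom.map_det] at h
  have hmap : (Polynomial.evalRingHom t).mapMatrix (1 + (Polynomial.X : Polynomial R) • M) =
      1 + t • P + t ^ 2 • Q := by
    rw [map_add, map_one, add_assoc]
    congr 1
    ext i j
    simp [M]
    ring
  rw [hmap] at h
  rw [h]
  simp only [Polynomial.coe_evalRingHom, Polynomial.eval_add, Polynomial.eval_mul,
    Polynomial.eval_pow, Polynomial.eval_X, Polynomial.eval_C, Polynomial.eval_one]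
  ring

/-- If `g(t) = A + t•B + t²•C` with `A` symmetric positive definite, then
`√(det g(t)) = √(det A)·(1 + (t/2)·trace(A⁻¹B)) + O(t²)` as `t → 0`. -/
theorem sqrt_det_expansion (d : ℕ) (hd : 1 ≤ d)
    (A B C : Matrix (Fin d) (Fin d) ℝ) (hA : A.PosDef) :
    (fun t : ℝ => Real.sqrt (A + t • B + t ^ 2 • C).det
        - Real.sqrt A.det * (1 + t / 2 * (A⁻¹ * B).trace))
      =O[nhds (0 : ℝ)] (fun t : ℝ => t ^ 2) := by
  obtain ⟨q, hq⟩ := Matrix.exists_det_one_add_smul_add_sq_smul (A⁻¹ * B) (A⁻¹ * C)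
  set τ := (A⁻¹ * B).trace
  have hdet : IsUnit A.det := hA.det_pos.ne'.isUnit
  have hfac (t : ℝ) : A + t • B + t ^ 2 • C =
      A * (1 + t • (A⁻¹ * B) + t ^ 2 • (A⁻¹ * C)) := by
    simp [mul_add, Matrix.mul_nonsing_inv_cancel_left _ _ hdet]
  let y : ℝ → ℝ := fun t => t * (τ + t * q.eval t)
  have hrew (t : ℝ) : Real.sqrt (A + t • B + t ^ 2 • C).det
        - Real.sqrt A.det * (1 + t / 2 * τ) =
      Real.sqrt A.det * ((Real.sqrt (1 + y t) - (1 + y t / 2)) + t ^ 2 * (q.eval t / 2)) := by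
    rw [hfac, Matrix.det_mul, hq, Real.sqrt_mul hA.det_pos.le,
      show 1 + t * τ + t ^ 2 * q.eval t = 1 + y t by simp only [y]; ring]
    simp only [y]
    ring
  simp only [hrew]
  have bounded {f : ℝ → ℝ} (hf : Continuous f) : f =O[nhds 0] (fun _ => (1 : ℝ)) :=
    hf.continuousAt.isBigO_one ℝ
  have hy : y =O[nhds 0] (fun t : ℝ => t) := by
    simpa using (isBigO_refl (fun t : ℝ => t) (nhds 0)).mul
      (bounded (f := fun t => τ + t * q.eval t) (by fun_prop))
  refine IsBigO.const_mul_left (IsBigO.add ?_ ?_) _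
  · refine IsBigO.trans (IsBigO.of_bound (1 / 2) (Eventually.of_forall fun t => ?_)) (hy.pow 2)
    have := Real.abs_sqrt_one_add_sub_le (y t)
    rw [Real.norm_eq_abs, Real.norm_of_nonneg (sq_nonneg _)]
    linarith
  · simpa using (isBigO_refl (fun t : ℝ => t ^ 2) (nhds 0)).mul
      (bounded (f := fun t => q.eval t / 2) (by fun_prop))
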